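/- Let d ∈ ℕ, 1 < p ≤ 2, 0 < θ ≤ 2 and r ≥ 0. Then there is a constant C > 0 such that for every f ∈ S^{r+1/p+1/θ−1}_{p,θ}B one has ‖f‖_{S^r_θ A} ≤ C · ‖f‖_{S^{r+1/p+1/θ−1}_{p,θ}B}, i.e. S^{r+1/p+1/θ−1}_{p,θ}B ↪ S^r_θ A. -/

import Mathlib

open MeasureTheory Real ENNReal

noncomputable section

namespace Paper

/-- The fundamental domain `[0,1)^d` of the `d`-dimensional torus `𝕋^d`. -/
def cube (d : ℕ) : Set (Fin d → ℝ) := Set.univ.pi fun _ => Set.Ico (0:ℝ) 1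

/-- The trigonometric character `x ↦ e^{2π i k·x}`. -/
def expk (d : ℕ) (k : Fin d → ℤ) (x : Fin d → ℝ) : ℂ :=
  Complex.exp (((2 * Real.pi * ∑ i, (k i : ℝ) * x i : ℝ) : ℂ) * Complex.I)

/-- Fourier coefficient `f̂(k) = ∫_{[0,1)^d} f(x) e^{-2π i k·x} dx`. -/
def fCoeff (d : ℕ) (f : (Fin d → ℝ) → ℂ) (k : Fin d → ℤ) : ℂ :=
  ∫ x in cube d, f x * expk d (-k) x

/-- The `L_q` (quasi-)norm on the torus, `q ∈ (0,∞]`, valued in `ℝ≥0∞`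
(for `q = ∞` this is the essential supremum). -/
def LqNorm (d : ℕ) (q : ℝ≥0∞) (f : (Fin d → ℝ) → ℂ) : ℝ≥0∞ :=
  eLpNorm f q (volume.restrict (cube d))

/-- The weight `∏_{i=1}^d (1+|k_i|)`. -/
def wt (d : ℕ) (k : Fin d → ℤ) : ℝ := ∏ i, (1 + |(k i : ℝ)|)

/-- The weighted Wiener (quasi-)norm `‖f‖_{S^r_θ A}`
(with the sup modification for `θ = ∞`); `A_θ` corresponds to `r = 0`,
the Wiener algebra `A` to `r = 0`, `θ = 1`. -/
def wienerNorm (d : ℕ) (r : ℝ) (θ : ℝ≥0∞) (f : (Fin d → ℝ) → ℂ) : ℝ≥0∞ :=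
  if θ = ∞ then ⨆ k : Fin d → ℤ, ENNReal.ofReal (wt d k ^ r) * (‖fCoeff d f k‖₊ : ℝ≥0∞)
  else (∑' k : Fin d → ℤ,
      (ENNReal.ofReal (wt d k ^ r) * (‖fCoeff d f k‖₊ : ℝ≥0∞)) ^ θ.toReal) ^ (1 / θ.toReal)

/-- Trigonometric polynomials with at most `m` terms. -/
def trigPoly (d m : ℕ) : Set ((Fin d → ℝ) → ℂ) :=
  {s | ∃ (Λ : Finset (Fin d → ℤ)) (a : (Fin d → ℤ) → ℂ),
    Λ.card ≤ m ∧ s = fun x => ∑ k ∈ Λ, a k * expk d k x}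

/-- Best `m`-term trigonometric approximation error of `f`, error measured by `X`. -/
def sigmaF (d m : ℕ) (X : ((Fin d → ℝ) → ℂ) → ℝ≥0∞) (f : (Fin d → ℝ) → ℂ) : ℝ≥0∞ :=
  ⨅ s ∈ trigPoly d m, X (f - s)

/-- The unit ball of the space (inside `L₁(𝕋^d)`) with (quasi-)norm `N`. -/
def unitBall (d : ℕ) (N : ((Fin d → ℝ) → ℂ) → ℝ≥0∞) : Set ((Fin d → ℝ) → ℂ) :=
  {f | IntegrableOn f (cube d) ∧ N f ≤ 1}

/-- Best `m`-term trigonometric width of the unit ball of `N`, error measured by `X`. -/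
def sigmaClass (d m : ℕ) (N X : ((Fin d → ℝ) → ℂ) → ℝ≥0∞) : ℝ≥0∞ :=
  ⨆ f ∈ unitBall d N, sigmaF d m X f

/-- `log*(m) = max (log₂ m) 1`. -/
def logStar (m : ℕ) : ℝ := max (Real.logb 2 m) 1

/-- Two-sided asymptotic equivalence `a_m ≍ b_m`. -/
def IsAsympEquiv (a : ℕ → ℝ≥0∞) (b : ℕ → ℝ) : Prop :=
  ∃ c C : ℝ, 0 < c ∧ 0 < C ∧ ∃ m₀ : ℕ, ∀ m : ℕ, m₀ ≤ m →
    ENNReal.ofReal (c * b m) ≤ a m ∧ a m ≤ ENNReal.ofReal (C * b m)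

/-- One-sided asymptotic bound `a_m ≲ b_m`. -/
def IsAsympLe (a : ℕ → ℝ≥0∞) (b : ℕ → ℝ) : Prop :=
  ∃ C : ℝ, 0 < C ∧ ∃ m₀ : ℕ, ∀ m : ℕ, m₀ ≤ m → a m ≤ ENNReal.ofReal (C * b m)

/-- Dyadic block `I_0 = {0}`, `I_n = {k : 2^{n-1} ≤ |k| < 2^n}` for `n ≥ 1`. -/
def blockF (n : ℕ) : Finset ℤ :=
  (Finset.Icc (-(2^n : ℤ)) (2^n)).filter fun k =>
    (n = 0 ∧ k = 0) ∨ (n ≠ 0 ∧ 2^(n-1) ≤ |k| ∧ |k| < 2^n)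

/-- The dyadic block projection `∑_{k ∈ I_j} f̂(k) e^{2π i k·x}`. -/
def blockProj (d : ℕ) (f : (Fin d → ℝ) → ℂ) (j : Fin d → ℕ) : (Fin d → ℝ) → ℂ :=
  fun x => ∑ k ∈ Fintype.piFinset (fun i => blockF (j i)), fCoeff d f k * expk d k x

/-- The mixed-smoothness Besov (quasi-)norm `‖f‖_{S^s_{p,θ}B}`
(with the sup modification for `θ = ∞`). -/
def besovNorm (d : ℕ) (s : ℝ) (p θ : ℝ≥0∞) (f : (Fin d → ℝ) → ℂ) : ℝ≥0∞ :=
  if θ = ∞ then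
    ⨆ j : Fin d → ℕ,
      ENNReal.ofReal ((2:ℝ) ^ (((∑ i, j i : ℕ) : ℝ) * s)) * LqNorm d p (blockProj d f j)
  else
    (∑' j : Fin d → ℕ,
      (ENNReal.ofReal ((2:ℝ) ^ (((∑ i, j i : ℕ) : ℝ) * s)) * LqNorm d p (blockProj d f j))
        ^ θ.toReal) ^ (1 / θ.toReal)

/-- The mixed-smoothness Sobolev norm `‖f‖_{S^s_p W}` (Littlewood–Paley form),
with `S^0_p W := L_p`. -/
def sobolevNorm (d : ℕ) (s : ℝ) (p : ℝ≥0∞) (f : (Fin d → ℝ) → ℂ) : ℝ≥0∞ :=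
  if s = 0 then LqNorm d p f
  else
    (∫⁻ x in cube d,
      ((∑' j : Fin d → ℕ,
        (ENNReal.ofReal ((2:ℝ) ^ (((∑ i, j i : ℕ) : ℝ) * s)) *
          (‖blockProj d f j x‖₊ : ℝ≥0∞)) ^ (2:ℕ)) ^ ((1:ℝ)/2)) ^ p.toReal) ^ (1 / p.toReal)

/-- Trigonometric polynomials with frequencies in `[-M,M]^d`. -/
def boxPoly (d M : ℕ) : Set ((Fin d → ℝ) → ℂ) :=
  {s | ∃ (Λ : Finset (Fin d → ℤ)) (a : (Fin d → ℤ) → ℂ),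
    (∀ k ∈ Λ, ∀ i, |k i| ≤ (M : ℤ)) ∧ s = fun x => ∑ k ∈ Λ, a k * expk d k x}

/-- Error of best approximation by trigonometric polynomials with
frequencies in `[-M,M]^d`, measured in `L_∞`. -/
def EBox (d M : ℕ) (f : (Fin d → ℝ) → ℂ) : ℝ≥0∞ :=
  ⨅ g ∈ boxPoly d M, LqNorm d ∞ (f - g)

/-- The `m`-th (non-linear) sampling width of the class of continuous functions
in the unit ball of `N`, error measured in `L_q`. -/
def samplingWidth (d m : ℕ) (N : ((Fin d → ℝ) → ℂ) → ℝ≥0∞) (q : ℝ≥0∞) : ℝ≥0∞ :=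
  ⨅ (t : Fin m → (Fin d → ℝ)) (_ : ∀ i, t i ∈ cube d)
    (R : (Fin m → ℂ) → ((Fin d → ℝ) → ℂ)),
    ⨆ f ∈ {f : (Fin d → ℝ) → ℂ | Continuous f ∧ N f ≤ 1},
      LqNorm d q (f - R fun i => f (t i))


theorem continuous_expk (d : ℕ) (k : Fin d → ℤ) : Continuous (expk d k) := by
  unfold expk
  fun_prop

theorem norm_expk (d : ℕ) (k : Fin d → ℤ) (x : Fin d → ℝ) : ‖expk d k x‖ = 1 :=
  Complex.norm_exp_ofReal_mul_I _

theorem expk_mul_conj (d : ℕ) (k l : Fin d → ℤ) (x : Fin d → ℝ) :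
    expk d k x * (starRingEnd ℂ) (expk d l x) = expk d (k - l) x := by
  unfold expk
  rw [← Complex.exp_conj, ← Complex.exp_add]
  congr 1
  simp only [map_mul, Complex.conj_ofReal, Complex.conj_I, Pi.sub_apply, Int.cast_sub, sub_mul,
    Finset.sum_sub_distrib]
  push_cast
  ring

theorem volume_restrict_cube (d : ℕ) :
    (volume : Measure (Fin d → ℝ)).restrict (cube d) =
      Measure.pi fun _ => volume.restrict (Set.Ico (0:ℝ) 1) := by
  rw [volume_pi, cube, Measure.restrict_pi_pi]

instance isProbabilityMeasure_restrict_cube (d : ℕ) :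
    IsProbabilityMeasure ((volume : Measure (Fin d → ℝ)).restrict (cube d)) := by
  have : IsProbabilityMeasure ((volume : Measure ℝ).restrict (Set.Ico (0:ℝ) 1)) := ⟨by simp⟩
  rw [volume_restrict_cube]
  infer_instance

theorem integral_exp_Ico (n : ℤ) :
    ∫ t in Set.Ico (0:ℝ) 1, Complex.exp (((2 * Real.pi * ((n : ℝ) * t) : ℝ) : ℂ) * Complex.I) =
      if n = 0 then 1 else 0 := by
  rw [integral_Ico_eq_integral_Ioc, ← intervalIntegral.integral_of_le zero_le_one]
  split_ifs with h
  · simp [h]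
  · have hc : (2 * Real.pi * n * Complex.I : ℂ) ≠ 0 := by
      simp [Real.pi_ne_zero, h]
    have := integral_exp_mul_complex (a := 0) (b := 1) hc
    rw [show (2 * Real.pi * n * Complex.I * (1 : ℝ) : ℂ) = n * (2 * Real.pi * Complex.I) by
      push_cast; ring, Complex.exp_int_mul_two_pi_mul_I] at this
    simp only [Complex.ofReal_zero, mul_zero, Complex.exp_zero, sub_self, zero_div] at this
    rw [← this]
    congr 1
    ext t
    congr 1
    push_cast
    ring

theorem integral_expk (d : ℕ) (k : Fin d → ℤ) :
    ∫ x in cube d, expk d k x = if k = 0 then 1 else 0 := by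
  have h : ∀ x, expk d k x =
      ∏ i, Complex.exp (((2 * Real.pi * ((k i : ℝ) * x i) : ℝ) : ℂ) * Complex.I) := by
    intro x
    rw [← Complex.exp_sum, ← Finset.sum_mul, ← Complex.ofReal_sum, ← Finset.mul_sum]
    rfl
  simp_rw [h]
  rw [volume_restrict_cube, integral_fintype_prod_eq_prod (𝕜 := ℂ)
    (f := fun i t => Complex.exp (((2 * Real.pi * ((k i : ℝ) * t) : ℝ) : ℂ) * Complex.I))]
  simp_rw [integral_exp_Ico]
  split_ifs with hk
  · simp [hk]
  · obtain ⟨i, hi⟩ := Function.ne_iff.mp hk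
    exact Finset.prod_eq_zero (Finset.mem_univ i) (if_neg hi)

theorem continuous_sum_expk (d : ℕ) (Λ : Finset (Fin d → ℤ)) (a : (Fin d → ℤ) → ℂ) :
    Continuous fun x => ∑ k ∈ Λ, a k * expk d k x :=
  continuous_finsetSum _ fun k _ => continuous_const.mul (continuous_expk d k)

/-- Parseval's identity for trigonometric polynomials. -/
theorem lintegral_sum_expk_sq (d : ℕ) (Λ : Finset (Fin d → ℤ)) (a : (Fin d → ℤ) → ℂ) :
    ∫⁻ x in cube d, ‖∑ k ∈ Λ, a k * expk d k x‖ₑ ^ (2:ℝ) = ∑ k ∈ Λ, ‖a k‖ₑ ^ (2:ℝ) := by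
  have hint : ∀ k : Fin d → ℤ, IntegrableOn (expk d k) (cube d) := fun k =>
    Integrable.of_bound (continuous_expk d k).aestronglyMeasurable 1
      (Filter.Eventually.of_forall fun x => (norm_expk d k x).le)
  have hsq : ∀ x, ((‖∑ k ∈ Λ, a k * expk d k x‖ ^ 2 : ℝ) : ℂ) =
      ∑ k ∈ Λ, ∑ l ∈ Λ, a k * (starRingEnd ℂ) (a l) * expk d (k - l) x := by
    intro x
    rw [Complex.ofReal_pow, ← Complex.mul_conj', map_sum, Finset.sum_mul_sum]
    refine Finset.sum_congr rfl fun k _ => Finset.sum_congr rfl fun l _ => ?_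
    rw [← expk_mul_conj, map_mul]
    ring
  have hI : ∫ x in cube d, ‖∑ k ∈ Λ, a k * expk d k x‖ ^ 2 = ∑ k ∈ Λ, ‖a k‖ ^ 2 := by
    apply Complex.ofReal_injective
    rw [← integral_complex_ofReal]
    simp_rw [hsq]
    rw [integral_finsetSum _ fun k _ => integrable_finsetSum _ fun l _ => (hint _).const_mul _,
      Complex.ofReal_sum]
    refine Finset.sum_congr rfl fun k hk => ?_
    rw [integral_finsetSum _ fun l _ => (hint _).const_mul _]
    simp_rw [integral_const_mul, integral_expk, sub_eq_zero]
    simp [hk, Complex.mul_conj']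
  have hof : ∀ z : ℂ, ‖z‖ₑ ^ (2:ℝ) = ENNReal.ofReal (‖z‖ ^ 2) := by
    intro z
    rw [ENNReal.ofReal_pow (norm_nonneg z), ofReal_norm, ← ENNReal.rpow_natCast]
    norm_num
  simp_rw [hof]
  rw [← ENNReal.ofReal_sum_of_nonneg fun k _ => by positivity, ← hI,
    ofReal_integral_eq_lintegral_ofReal]
  · refine Integrable.of_bound
      ((continuous_sum_expk d Λ a).norm.pow 2).aestronglyMeasurable ((∑ k ∈ Λ, ‖a k‖) ^ 2)
      (Filter.Eventually.of_forall fun x => ?_)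
    rw [norm_pow, norm_norm]
    gcongr
    refine (norm_sum_le _ _).trans_eq (Finset.sum_congr rfl fun k _ => ?_)
    rw [norm_mul, norm_expk, mul_one]
  · exact Filter.Eventually.of_forall fun x => by positivity

theorem sum_rpow_rpow_inv_le {ι : Type*} (Λ : Finset ι) (b : ι → ℝ≥0∞) {N T : ℝ}
    (hN : (Λ.card : ℝ) ≤ N) (hT : 0 < T) (hT2 : T ≤ 2) :
    (∑ k ∈ Λ, b k ^ T) ^ (1 / T) ≤
      ENNReal.ofReal N ^ (1 / T - 1 / 2) * (∑ k ∈ Λ, b k ^ (2:ℝ)) ^ (1 / 2 : ℝ) := by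
  have h1 : 1 ≤ 2 / T := by rwa [le_div_iff₀ hT, one_mul]
  have h := ENNReal.rpow_sum_le_const_mul_sum_rpow Λ (fun k => b k ^ T) h1
  simp_rw [← ENNReal.rpow_mul, mul_div_cancel₀ (2:ℝ) hT.ne'] at h
  have hNe : (Λ.card : ℝ≥0∞) ≤ ENNReal.ofReal N := by
    rw [← ENNReal.ofReal_natCast]
    exact ENNReal.ofReal_le_ofReal hN
  have h2 := ENNReal.rpow_le_rpow (h.trans (mul_le_mul_left
    (ENNReal.rpow_le_rpow hNe (sub_nonneg.2 h1)) _)) (show (0:ℝ) ≤ 1 / 2 by norm_num)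
  rw [ENNReal.mul_rpow_of_nonneg _ _ (by norm_num), ← ENNReal.rpow_mul, ← ENNReal.rpow_mul] at h2
  convert h2 using 3 <;> ring

/-- Nikolskii's inequality between `L_2` and `L_p`, `p ≤ 2`. -/
theorem sum_sq_rpow_half_le (d : ℕ) (Λ : Finset (Fin d → ℤ)) (a : (Fin d → ℤ) → ℂ) {N : ℝ}
    (hN : (Λ.card : ℝ) ≤ N) (hN0 : 0 < N) {p : ℝ≥0∞} (hp0 : 0 < p) (hp2 : p ≤ 2) :
    (∑ k ∈ Λ, ‖a k‖ₑ ^ (2:ℝ)) ^ (1 / 2 : ℝ) ≤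
      ENNReal.ofReal N ^ (1 / p.toReal - 1 / 2) *
        LqNorm d p fun x => ∑ k ∈ Λ, a k * expk d k x := by
  have hpt : p ≠ ∞ := ne_top_of_le_ne_top (by simp) hp2
  have hP : 0 < p.toReal := ENNReal.toReal_pos hp0.ne' hpt
  have hP2 : p.toReal ≤ 2 := by simpa using ENNReal.toReal_mono (by simp) hp2
  rw [LqNorm, eLpNorm_eq_lintegral_rpow_enorm_toReal hp0.ne' hpt]
  have hpars := lintegral_sum_expk_sq d Λ a
  set P := p.toReal
  set S := ∑ k ∈ Λ, ‖a k‖ₑ ^ (2:ℝ)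
  set L := ∫⁻ x in cube d, ‖∑ k ∈ Λ, a k * expk d k x‖ₑ ^ P
  set n := ENNReal.ofReal N
  have hn0 : n ≠ 0 := (ENNReal.ofReal_pos.2 hN0).ne'
  have hnt : n ≠ ∞ := ENNReal.ofReal_ne_top
  have hSt : S ≠ ∞ := ENNReal.sum_ne_top.2 fun k _ =>
    ENNReal.rpow_ne_top_of_nonneg (by norm_num) enorm_ne_top
  rcases eq_or_ne S 0 with hS0 | hS0
  · rw [hS0, ENNReal.zero_rpow_of_pos (by norm_num)]
    exact zero_le
  have hsup : ∀ x, ‖∑ k ∈ Λ, a k * expk d k x‖ₑ ≤ (n * S) ^ (1 / 2 : ℝ) := by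
    intro x
    have h1 := sum_rpow_rpow_inv_le Λ (fun k => ‖a k‖ₑ) hN one_pos one_le_two
    simp only [ENNReal.rpow_one, div_one] at h1
    rw [ENNReal.mul_rpow_of_nonneg _ _ (by norm_num)]
    refine (enorm_sum_le _ _).trans ((Finset.sum_le_sum fun k _ => ?_).trans
      (h1.trans_eq (by norm_num [n, S])))
    rw [enorm_mul, ← ofReal_norm (expk d k x), norm_expk]
    simp
  have hSL : S ≤ (n * S) ^ ((2 - P) / 2) * L := by
    rw [← hpars]
    calc ∫⁻ x in cube d, ‖∑ k ∈ Λ, a k * expk d k x‖ₑ ^ (2:ℝ)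
        ≤ ∫⁻ x in cube d, (n * S) ^ ((2 - P) / 2) * ‖∑ k ∈ Λ, a k * expk d k x‖ₑ ^ P := by
          refine lintegral_mono fun x => ?_
          have h2 := ENNReal.rpow_le_rpow (hsup x) (sub_nonneg.2 hP2)
          rw [← ENNReal.rpow_mul] at h2
          calc ‖∑ k ∈ Λ, a k * expk d k x‖ₑ ^ (2:ℝ)
              = ‖∑ k ∈ Λ, a k * expk d k x‖ₑ ^ (2 - P) * ‖∑ k ∈ Λ, a k * expk d k x‖ₑ ^ P := by
                rw [← ENNReal.rpow_add_of_nonneg _ _ (sub_nonneg.2 hP2) hP.le, sub_add_cancel]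
            _ ≤ _ := by
                refine mul_le_mul_left (h2.trans_eq ?_) _
                congr 1
                ring
      _ = _ := lintegral_const_mul' _ _ (ENNReal.rpow_ne_top_of_nonneg (by linarith)
            (ENNReal.mul_ne_top hnt hSt))
      _ = _ := by rw [hpars]
  have hSP : S ^ (P / 2) ≤ n ^ ((2 - P) / 2) * L := by
    have h3 := mul_le_mul_right hSL (S ^ (-((2 - P) / 2)))
    rw [ENNReal.mul_rpow_of_nonneg _ _ (by linarith)] at h3
    calc S ^ (P / 2) = S ^ (-((2 - P) / 2)) * S := by
          nth_rewrite 3 [← ENNReal.rpow_one S]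
          rw [← ENNReal.rpow_add _ _ hS0 hSt]
          congr 1
          ring
      _ ≤ _ := h3
      _ = (S ^ (-((2 - P) / 2)) * S ^ ((2 - P) / 2)) * (n ^ ((2 - P) / 2) * L) := by ring
      _ = _ := by rw [← ENNReal.rpow_add _ _ hS0 hSt, neg_add_cancel, ENNReal.rpow_zero, one_mul]
  have h4 := ENNReal.rpow_le_rpow hSP (show 0 ≤ 1 / P by positivity)
  rw [ENNReal.mul_rpow_of_nonneg _ _ (by positivity), ← ENNReal.rpow_mul, ← ENNReal.rpow_mul] at h4
  convert h4 using 3 <;> field_simp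

theorem abs_lt_of_mem_blockF {n : ℕ} {k : ℤ} (hk : k ∈ blockF n) : |k| < 2 ^ n := by
  rcases (Finset.mem_filter.1 hk).2 with ⟨rfl, rfl⟩ | h
  · simp
  · exact h.2.2

theorem card_blockF_le (n : ℕ) : (blockF n).card ≤ 2 ^ n := by
  rcases n with _ | n
  · have : blockF 0 ⊆ {0} := fun k hk => by
      have := abs_lt_of_mem_blockF hk
      rw [pow_zero, Int.abs_lt_one_iff] at this
      simpa
    simpa using Finset.card_le_card this
  · have : blockF (n + 1) ⊆ Finset.Ico ((2:ℤ) ^ n) (2 ^ (n + 1)) ∪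
        Finset.Ioc (-2 ^ (n + 1)) (-(2:ℤ) ^ n) := fun k hk => by
      have h := (Finset.mem_filter.1 hk).2
      simp only [Nat.add_sub_cancel] at h
      simp only [Finset.mem_union, Finset.mem_Ico, Finset.mem_Ioc]
      rcases abs_cases k with hk | hk <;> omega
    refine (Finset.card_le_card this).trans ((Finset.card_union_le _ _).trans ?_)
    simp only [Int.card_Ico, Int.card_Ioc, pow_succ]
    have : ((2 ^ n : ℕ) : ℤ) = 2 ^ n := by push_cast; rfl
    omega

theorem mem_blockF_size (k : ℤ) : k ∈ blockF k.natAbs.size := by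
  have hlt := Nat.lt_size_self k.natAbs
  have hlt' : |k| < 2 ^ k.natAbs.size := by
    rw [Int.abs_eq_natAbs]
    exact_mod_cast hlt
  refine Finset.mem_filter.2 ⟨Finset.mem_Icc.2 (abs_le.1 hlt'.le), ?_⟩
  rcases eq_or_ne k 0 with rfl | hk
  · simp
  · have h0 : k.natAbs.size ≠ 0 := by simpa [Nat.size_eq_zero] using hk
    refine Or.inr ⟨h0, ?_, hlt'⟩
    rw [Int.abs_eq_natAbs]
    exact_mod_cast Nat.lt_size.1 (Nat.sub_lt (Nat.pos_of_ne_zero h0) one_pos)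

/-- The multi-index of the dyadic block containing `k`. -/
def blockIndex (d : ℕ) (k : Fin d → ℤ) : Fin d → ℕ := fun i => (k i).natAbs.size

theorem mem_block_blockIndex (d : ℕ) (k : Fin d → ℤ) :
    k ∈ Fintype.piFinset fun i => blockF (blockIndex d k i) :=
  Fintype.mem_piFinset.2 fun i => mem_blockF_size (k i)

theorem tsum_le_tsum_sum_block (d : ℕ) (F : (Fin d → ℤ) → ℝ≥0∞) :
    ∑' k, F k ≤ ∑' j : Fin d → ℕ, ∑ k ∈ Fintype.piFinset fun i => blockF (j i), F k := by
  calc ∑' k, F k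
      = ∑' k, ∑' j : Fin d → ℕ, if j = blockIndex d k then F k else 0 := by
        simp_rw [tsum_ite_eq]
    _ = ∑' j : Fin d → ℕ, ∑' k, if j = blockIndex d k then F k else 0 := ENNReal.tsum_comm
    _ ≤ _ := by
        refine ENNReal.tsum_le_tsum fun j => ?_
        rw [tsum_eq_sum (s := Fintype.piFinset fun i => blockF (j i))]
        · exact Finset.sum_le_sum fun k _ => by split_ifs <;> simp
        · intro k hk
          rw [if_neg]
          rintro rfl
          exact hk (mem_block_blockIndex d k)

theorem wt_le_of_mem_block (d : ℕ) {j : Fin d → ℕ} {k : Fin d → ℤ}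
    (hk : k ∈ Fintype.piFinset fun i => blockF (j i)) : wt d k ≤ 2 ^ ∑ i, j i := by
  rw [wt, ← Finset.prod_pow_eq_pow_sum]
  refine Finset.prod_le_prod (fun i _ => by positivity) fun i _ => ?_
  have := Int.add_one_le_iff.2 (abs_lt_of_mem_blockF (Fintype.mem_piFinset.1 hk i))
  rw [add_comm]
  exact_mod_cast this

theorem card_block_le (d : ℕ) (j : Fin d → ℕ) :
    (Fintype.piFinset fun i => blockF (j i)).card ≤ 2 ^ ∑ i, j i := by
  rw [Fintype.card_piFinset, ← Finset.prod_pow_eq_pow_sum]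
  exact Finset.prod_le_prod' fun i _ => card_blockF_le (j i)

theorem sum_block_le (d : ℕ) {p θ : ℝ≥0∞} (hp0 : 0 < p) (hp2 : p ≤ 2)
    (hθ : 0 < θ) (hθ2 : θ ≤ 2) {r : ℝ} (hr : 0 ≤ r) (f : (Fin d → ℝ) → ℂ) (j : Fin d → ℕ) :
    ∑ k ∈ Fintype.piFinset fun i => blockF (j i),
        (ENNReal.ofReal (wt d k ^ r) * (‖fCoeff d f k‖₊ : ℝ≥0∞)) ^ θ.toReal ≤
      (ENNReal.ofReal ((2:ℝ) ^ (((∑ i, j i : ℕ) : ℝ) * (r + 1/p.toReal + 1/θ.toReal - 1))) *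
        LqNorm d p (blockProj d f j)) ^ θ.toReal := by
  have hT : 0 < θ.toReal := ENNReal.toReal_pos hθ.ne' (ne_top_of_le_ne_top (by simp) hθ2)
  have hT2 : θ.toReal ≤ 2 := by simpa using ENNReal.toReal_mono (by simp) hθ2
  set T := θ.toReal
  set P := p.toReal
  set Λ := Fintype.piFinset fun i => blockF (j i)
  set N : ℝ := 2 ^ ∑ i, j i with hNdef
  have hN0 : 0 < N := by positivity
  have hn0 : ENNReal.ofReal N ≠ 0 := (ENNReal.ofReal_pos.2 hN0).ne'
  have hcard : (Λ.card : ℝ) ≤ N := by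
    rw [hNdef]
    exact_mod_cast card_block_le d j
  have hwt : ∀ k ∈ Λ, ENNReal.ofReal (wt d k ^ r) ≤ ENNReal.ofReal N ^ r := by
    intro k hk
    rw [ENNReal.ofReal_rpow_of_pos hN0]
    refine ENNReal.ofReal_le_ofReal (Real.rpow_le_rpow ?_ (wt_le_of_mem_block d hk) hr)
    exact Finset.prod_nonneg fun i _ => by positivity
  have hmain : (∑ k ∈ Λ, ‖fCoeff d f k‖ₑ ^ T) ^ (1 / T) ≤
      ENNReal.ofReal N ^ (1 / P + 1 / T - 1) * LqNorm d p (blockProj d f j) := by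
    refine (sum_rpow_rpow_inv_le Λ (fun k => ‖fCoeff d f k‖ₑ) hcard hT hT2).trans
      ((mul_le_mul_right (sum_sq_rpow_half_le d Λ (fCoeff d f) hcard hN0 hp0 hp2) _).trans_eq ?_)
    rw [← mul_assoc, ← ENNReal.rpow_add _ _ hn0 ENNReal.ofReal_ne_top]
    congr 2
    ring
  calc ∑ k ∈ Λ, (ENNReal.ofReal (wt d k ^ r) * (‖fCoeff d f k‖₊ : ℝ≥0∞)) ^ T
      ≤ ∑ k ∈ Λ, (ENNReal.ofReal N ^ r) ^ T * ‖fCoeff d f k‖ₑ ^ T := by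
        refine Finset.sum_le_sum fun k hk => ?_
        rw [← ENNReal.mul_rpow_of_nonneg _ _ hT.le]
        exact ENNReal.rpow_le_rpow (mul_le_mul_left (hwt k hk) _) hT.le
    _ = (ENNReal.ofReal N ^ r * (∑ k ∈ Λ, ‖fCoeff d f k‖ₑ ^ T) ^ (1 / T)) ^ T := by
        rw [← Finset.mul_sum, ENNReal.mul_rpow_of_nonneg _ _ hT.le,
          ← ENNReal.rpow_mul _ (1 / T) T, one_div_mul_cancel hT.ne', ENNReal.rpow_one]
    _ ≤ _ := by
        refine ENNReal.rpow_le_rpow ((mul_le_mul_right hmain _).trans_eq ?_) hT.le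
        rw [← mul_assoc, ← ENNReal.rpow_add _ _ hn0 ENNReal.ofReal_ne_top, Real.rpow_mul zero_le_two,
          Real.rpow_natCast, ← hNdef, ENNReal.ofReal_rpow_of_pos hN0]
        congr 3
        ring

/-- the embedding `S^{r+1/p+1/θ-1}_{p,θ}B ↪ S^r_θ A`
for `1 < p ≤ 2`, `0 < θ ≤ 2`, `r ≥ 0`. -/
theorem statement8 (d : ℕ) (hd : 1 ≤ d) (p θ : ℝ≥0∞) (hp1 : 1 < p) (hp2 : p ≤ 2)
    (hθ : 0 < θ) (hθ2 : θ ≤ 2) (r : ℝ) (hr : 0 ≤ r) :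
    ∃ C : ℝ, 0 < C ∧ ∀ f : (Fin d → ℝ) → ℂ, IntegrableOn f (cube d) →
      wienerNorm d r θ f ≤
        ENNReal.ofReal C * besovNorm d (r + 1/p.toReal + 1/θ.toReal - 1) p θ f := by
  have hθt : θ ≠ ∞ := ne_top_of_le_ne_top (by simp) hθ2
  refine ⟨1, one_pos, fun f _ => ?_⟩
  rw [ENNReal.ofReal_one, one_mul, wienerNorm, besovNorm, if_neg hθt, if_neg hθt]
  refine ENNReal.rpow_le_rpow ((tsum_le_tsum_sum_block d _).trans
    (ENNReal.tsum_le_tsum fun j => ?_)) (by positivity)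
  exact sum_block_le d (zero_lt_one.trans hp1) hp2 hθ hθ2 hr f j

end Paper
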